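/- Let τ = 321 ∈ S_3. For n ≥ 3, 2 ≤ l ≤ n-1, and 1 ≤ k, a ≤ n-l+1, let A^{(n)}_{l;k;a} denote the set of σ ∈ S_n with {σ_a, σ_{a+1}, …, σ_{a+l-1}} = {k, k+1, …, k+l-1}. Then |A^{(n)}_{l;k;a} ∩ S_n(321)| = |{η ∈ S_{n-l+1}(321) : η_a = k}| if a ≠ k, and |A^{(n)}_{l;k;a} ∩ S_n(321)| = |{η ∈ S_{n-l+1}(321) : η_a = k}| + C_{k-1}·C_{n-k-l+1}·(C_l - 1) if a = k. -/

import Mathlib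

open Filter

def Contains {n m : ℕ} (σ : Fin n → Fin n) (τ : Fin m → Fin m) : Prop :=
  ∃ f : Fin m → Fin n, StrictMono f ∧ ∀ j k : Fin m, σ (f j) < σ (f k) ↔ τ j < τ k

def Avoids {n m : ℕ} (σ : Fin n → Fin n) (τ : Fin m → Fin m) : Prop :=
  ¬ Contains σ τ

def AvoidSet (n : ℕ) {m : ℕ} (τ : Equiv.Perm (Fin m)) : Set (Equiv.Perm (Fin n)) :=
  {σ : Equiv.Perm (Fin n) | Avoids ⇑σ ⇑τ}

def ClusterAt {n : ℕ} (l k a : ℕ) (σ : Equiv.Perm (Fin n)) : Prop :=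
  (Finset.univ.filter fun i : Fin n => a ≤ (i : ℕ) + 1 ∧ (i : ℕ) + 1 < a + l).image
      (fun i => (σ i : ℕ) + 1) = Finset.Ico k (k + l)

def ClusterEvent (n l k : ℕ) : Set (Equiv.Perm (Fin n)) :=
  {σ : Equiv.Perm (Fin n) | ∃ a : ℕ, 1 ≤ a ∧ a ≤ n - l + 1 ∧ ClusterAt l k a σ}

def ClusterFree {m : ℕ} (τ : Equiv.Perm (Fin m)) : Prop :=
  ∀ l a k : ℕ, 2 ≤ l → l ≤ m - 1 → 1 ≤ a → a + l ≤ m + 1 → ¬ ClusterAt l k a τ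

def ContainsTightly12 {m : ℕ} (τ : Equiv.Perm (Fin m)) : Prop :=
  ∃ i j : Fin m, (j : ℕ) = (i : ℕ) + 1 ∧ (τ j : ℕ) = (τ i : ℕ) + 1

def ContainsTightly21 {m : ℕ} (τ : Equiv.Perm (Fin m)) : Prop :=
  ∃ i j : Fin m, (j : ℕ) = (i : ℕ) + 1 ∧ (τ i : ℕ) = (τ j : ℕ) + 1

def perm123 : Equiv.Perm (Fin 3) := Equiv.refl (Fin 3)

def perm321 : Equiv.Perm (Fin 3) :=
  ⟨![2, 1, 0], ![2, 1, 0], by intro x; fin_cases x <;> rfl, by intro x; fin_cases x <;> rfl⟩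

def p2413 : Equiv.Perm (Fin 4) :=
  ⟨![1, 3, 0, 2], ![2, 0, 3, 1], by intro x; fin_cases x <;> rfl, by intro x; fin_cases x <;> rfl⟩

def p3142 : Equiv.Perm (Fin 4) :=
  ⟨![2, 0, 3, 1], ![1, 3, 0, 2], by intro x; fin_cases x <;> rfl, by intro x; fin_cases x <;> rfl⟩

def SepSet (n : ℕ) : Set (Equiv.Perm (Fin n)) :=
  {σ : Equiv.Perm (Fin n) | Avoids ⇑σ ⇑p2413 ∧ Avoids ⇑σ ⇑p3142}


def Av {n : ℕ} (σ : Equiv.Perm (Fin n)) : Prop :=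
  ∀ i j k : Fin n, i < j → j < k → σ j < σ i → σ k < σ j → False

theorem avoids_iff {n : ℕ} (σ : Equiv.Perm (Fin n)) : Avoids ⇑σ ⇑perm321 ↔ Av σ := by
  constructor
  · intro h i j k hij hjk h1 h2
    apply h
    refine ⟨![i, j, k], ?_, ?_⟩
    · intro x y hxy
      fin_cases x <;> fin_cases y <;> simp_all <;> first | exact hij.trans hjk | omega
    · intro x y
      have h3 := h2.trans h1
      fin_cases x <;> fin_cases y <;> simp [perm321, h1, h2, h3, h1.le, h2.le, h3.le]
  · rintro h ⟨f, hf, h'⟩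
    refine h (f 0) (f 1) (f 2) (hf (by decide)) (hf (by decide)) ((h' _ _).2 (by decide)) ((h' _ _).2 (by decide))

def ins {n : ℕ} (p v : Fin (n+1)) (η : Equiv.Perm (Fin n)) : Equiv.Perm (Fin (n+1)) :=
  (finSuccEquiv' p).trans ((Equiv.optionCongr η).trans (finSuccEquiv' v).symm)

@[simp] theorem ins_self {n : ℕ} (p v : Fin (n+1)) (η : Equiv.Perm (Fin n)) : ins p v η p = v := by
  simp [ins]

@[simp] theorem ins_succAbove {n : ℕ} (p v : Fin (n+1)) (η : Equiv.Perm (Fin n)) (i : Fin n) :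
    ins p v η (p.succAbove i) = v.succAbove (η i) := by
  simp [ins]

theorem ins_inj {n : ℕ} (p v : Fin (n+1)) : Function.Injective (ins p v) := by
  intro η η' h
  ext i
  have := congrArg (fun e => e (p.succAbove i)) h
  simp only [ins_succAbove] at this
  rw [Fin.succAbove_right_injective this]

theorem ins_surj {n : ℕ} (p v : Fin (n+1)) (σ : Equiv.Perm (Fin (n+1))) (h : σ p = v) :
    ∃ η, ins p v η = σ := by
  have key : ∀ i : Fin n, ∃ j : Fin n, v.succAbove j = σ (p.succAbove i) := by
    intro i
    apply Fin.exists_succAbove_eq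
    rw [← h]
    intro h2
    exact Fin.succAbove_ne p i (σ.injective h2)
  choose f hf using key
  have finj : Function.Injective f := by
    intro i j hij
    have : σ (p.succAbove i) = σ (p.succAbove j) := by rw [← hf, ← hf, hij]
    exact Fin.succAbove_right_injective (σ.injective this)
  refine ⟨Equiv.ofBijective f (Finite.injective_iff_bijective.1 finj), ?_⟩
  apply Equiv.ext
  intro x
  rcases Fin.eq_self_or_eq_succAbove p x with rfl | ⟨i, rfl⟩
  · simp [h]
  · simp [hf]

theorem av_of_ins {n : ℕ} (p v : Fin (n+1)) (η : Equiv.Perm (Fin n)) (h : Av (ins p v η)) : Av η := by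
  intro i j k h1 h2 h3 h4
  apply h (p.succAbove i) (p.succAbove j) (p.succAbove k) <;> simpa [Fin.succAbove_lt_succAbove_iff]

/-- last `j` entries increasing -/
def Suf {n : ℕ} (j : ℕ) (σ : Equiv.Perm (Fin n)) : Prop :=
  ∀ x y : Fin n, x < y → n ≤ x + j → σ x < σ y

theorem av_ins_last {n : ℕ} (p : Fin (n+1)) (η : Equiv.Perm (Fin n)) :
    Av (ins p (Fin.last n) η) ↔ Av η ∧ Suf (n - p) η := by
  constructor
  · intro h
    refine ⟨av_of_ins _ _ _ h, ?_⟩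
    intro x y hxy hx
    by_contra hc
    have hne : η y ≠ η x := fun h => hxy.ne' (η.injective h)
    have hlt : η y < η x := lt_of_le_of_ne (not_lt.1 hc) hne
    have hp : p < p.succAbove x := by
      rw [Fin.lt_succAbove_iff_le_castSucc, Fin.le_def]; simp; omega
    refine h p (p.succAbove x) (p.succAbove y) hp (by simpa) ?_ (by simpa)
    simp
  · rintro ⟨h, hs⟩ i j k hij hjk h1 h2
    have hj : j ≠ p := by
      rintro rfl
      rw [ins_self] at h1
      exact absurd h1 (not_lt.2 (Fin.le_last _))
    have hk : k ≠ p := by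
      rintro rfl
      rw [ins_self] at h2
      exact absurd h2 (not_lt.2 (Fin.le_last _))
    obtain ⟨j, rfl⟩ := Fin.exists_succAbove_eq hj
    obtain ⟨k, rfl⟩ := Fin.exists_succAbove_eq hk
    rcases Fin.eq_self_or_eq_succAbove p i with rfl | ⟨i, rfl⟩
    · simp at h2 hjk
      rw [Fin.lt_succAbove_iff_le_castSucc, Fin.le_def] at hij
      simp at hij
      exact absurd (hs j k hjk (by omega)) (not_lt.2 h2.le)
    · simp at *
      exact h i j k hij hjk h1 h2

theorem suf_ins_end {n : ℕ} (j : ℕ) (η : Equiv.Perm (Fin n)) :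
    Suf j (ins (Fin.last n) (Fin.last n) η) ↔ Suf (j-1) η := by
  constructor
  · intro h x y hxy hx
    have := h ((Fin.last n).succAbove x) ((Fin.last n).succAbove y) (by simpa) (by simp; omega)
    rw [ins_succAbove, ins_succAbove] at this
    simpa using this
  · intro h x y hxy hx
    rcases Fin.eq_self_or_eq_succAbove (Fin.last n) x with rfl | ⟨x, rfl⟩
    · exact absurd hxy (not_lt.2 (Fin.le_last _))
    rcases Fin.eq_self_or_eq_succAbove (Fin.last n) y with rfl | ⟨y, rfl⟩
    · rw [ins_self, ins_succAbove]; simp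
    rw [ins_succAbove, ins_succAbove]
    simp at *
    exact h x y hxy (by omega)

theorem suf_ins_mid {n : ℕ} (j : ℕ) (p : Fin (n+1)) (hp : (p:ℕ) < n) (η : Equiv.Perm (Fin n))
    (hη : Suf (n-p) η) :
    Suf j (ins p (Fin.last n) η) ↔ p + j ≤ n := by
  constructor
  · intro h
    by_contra hc
    have := h p (Fin.last n) (by rw [Fin.lt_def]; simpa) (by omega)
    rw [ins_self] at this
    exact absurd this (not_lt.2 (Fin.le_last _))
  · intro h x y hxy hx
    have hx' : x ≠ p := by rintro rfl; omega
    have hy' : y ≠ p := by rintro rfl; rw [Fin.lt_def] at hxy; omega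
    obtain ⟨x, rfl⟩ := Fin.exists_succAbove_eq hx'
    obtain ⟨y, rfl⟩ := Fin.exists_succAbove_eq hy'
    simp at *
    have : p < p.succAbove x := by rw [Fin.lt_def]; omega
    rw [Fin.lt_succAbove_iff_le_castSucc, Fin.le_def] at this
    simp at this
    exact hη x y hxy (by omega)

noncomputable def g (n j : ℕ) : ℕ := {σ : Equiv.Perm (Fin n) | Av σ ∧ Suf j σ}.ncard

theorem g_rec (n j : ℕ) : g (n+1) j = g n (j-1) + ∑ p ∈ Finset.range (min n (n+1-j)), g n (n-p) := by
  classical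
  have h1 : g (n+1) j = ∑ p : Fin (n+1),
      {σ : Equiv.Perm (Fin (n+1)) | (Av σ ∧ Suf j σ) ∧ σ p = Fin.last n}.ncard := by
    unfold g
    simp only [Set.ncard_eq_toFinset_card']
    rw [Finset.card_eq_sum_card_fiberwise (f := fun σ => σ.symm (Fin.last n)) (t := Finset.univ)
      (by intro x _; simp)]
    apply Finset.sum_congr rfl
    intro p _
    congr 1
    ext σ
    simp only [Finset.mem_filter, Set.mem_toFinset, Set.mem_ofPred_eq]
    rw [Equiv.symm_apply_eq, eq_comm (a := Fin.last n)]
  have h2 : ∀ p : Fin (n+1), {σ : Equiv.Perm (Fin (n+1)) | (Av σ ∧ Suf j σ) ∧ σ p = Fin.last n}.ncard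
      = {η : Equiv.Perm (Fin n) | (Av η ∧ Suf (n-p) η) ∧ Suf j (ins p (Fin.last n) η)}.ncard := by
    intro p
    rw [← Set.ncard_image_of_injective _ (ins_inj p (Fin.last n))]
    congr 1
    ext σ
    constructor
    · rintro ⟨⟨h1, h2⟩, h3⟩
      obtain ⟨η, rfl⟩ := ins_surj _ _ _ h3
      exact ⟨η, ⟨(av_ins_last _ _).1 h1, h2⟩, rfl⟩
    · rintro ⟨η, ⟨h1, h2⟩, rfl⟩
      exact ⟨⟨(av_ins_last _ _).2 h1, h2⟩, by simp⟩
  rw [h1, Finset.sum_congr rfl (fun p _ => h2 p), Fin.sum_univ_castSucc, add_comm]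
  congr 1
  · unfold g
    congr 1
    ext η
    simp only [Set.mem_ofPred_eq, suf_ins_end]
    constructor
    · rintro ⟨⟨a, b⟩, c⟩; exact ⟨a, c⟩
    · rintro ⟨a, c⟩; exact ⟨⟨a, by intro x y hxy hx; simp at hx; omega⟩, c⟩
  · have h3 : ∀ p : Fin n, {η : Equiv.Perm (Fin n) | (Av η ∧ Suf (n-(p.castSucc : Fin (n+1))) η) ∧
        Suf j (ins p.castSucc (Fin.last n) η)}.ncard = if (p:ℕ) + j ≤ n then g n (n - p) else 0 := by
      intro p
      split_ifs with h
      · unfold g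
        congr 1
        ext η
        constructor
        · rintro ⟨a, b⟩; exact a
        · intro a; exact ⟨a, (suf_ins_mid j _ (by simp) η a.2).2 (by simpa)⟩
      · rw [Set.ncard_eq_zero]
        ext η
        simp only [Set.mem_ofPred_eq, Set.mem_empty_iff_false, iff_false]
        rintro ⟨a, b⟩
        exact h (by simpa using (suf_ins_mid j _ (by simp) η a.2).1 b)
    rw [Finset.sum_congr rfl (fun p _ => h3 p), Fin.sum_univ_eq_sum_range (fun p => if p + j ≤ n then g n (n-p) else 0), ← Finset.sum_filter]
    apply Finset.sum_congr _ (fun _ _ => rfl)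
    ext x
    simp
    omega

theorem hockey (n m : ℕ) : ∑ p ∈ Finset.range m, (((n+p).choose n : ℤ) - (n+p).choose (n+1)) =
    (n+m).choose (n+1) - (n+m).choose (n+2) := by
  induction m with
  | zero => simp [Nat.choose_eq_zero_of_lt]
  | succ m ih =>
    rw [Finset.sum_range_succ, ih, ← add_assoc, Nat.choose_succ_succ (n+m) n, Nat.choose_succ_succ (n+m) (n+1)]
    push_cast; ring

theorem g_zero_one (n : ℕ) : g n 0 = g n 1 := by
  unfold g
  congr 1
  ext σ
  have h0 : Suf 0 σ := by intro x y _ h; simp at h; omega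
  have h1 : Suf 1 σ := by intro x y h h'; rw [Fin.lt_def] at h; omega
  simp [h0, h1]

theorem G_zero_one (n : ℕ) : ((2*(n+1)).choose (n+1) : ℤ) - (2*(n+1)).choose (n+2) =
    (2*(n+1)-1).choose (n+1) - (2*(n+1)-1).choose (n+2) := by
  have e : 2*(n+1)-1 = 2*n+1 := by omega
  rw [e, show 2*(n+1) = (2*n+1)+1 by ring, Nat.choose_succ_succ (2*n+1) n, Nat.choose_succ_succ (2*n+1) (n+1),
    Nat.choose_symm_half]
  push_cast; ring

theorem g_formula (n : ℕ) : ∀ j, j ≤ n → (g n j : ℤ) = (2*n-j).choose n - (2*n-j).choose (n+1) := by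
  induction n with
  | zero =>
    intro j hj
    obtain rfl : j = 0 := by omega
    have : {σ : Equiv.Perm (Fin 0) | Av σ ∧ Suf 0 σ} = Set.univ := by
      ext σ; simp [Av, Suf]
    simp [g, this]
  | succ n ih =>
    have main : ∀ j, 1 ≤ j → j ≤ n+1 → (g (n+1) j : ℤ) = (2*(n+1)-j).choose (n+1) - (2*(n+1)-j).choose (n+1+1) := by
      intro j h1 hj
      rw [g_rec, show min n (n+1-j) = n+1-j by omega]
      push_cast
      rw [ih (j-1) (by omega)]
      have : ∑ p ∈ Finset.range (n+1-j), (g n (n-p) : ℤ) =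
        ∑ p ∈ Finset.range (n+1-j), (((n+p).choose n : ℤ) - (n+p).choose (n+1)) := by
        apply Finset.sum_congr rfl
        intro p hp
        rw [Finset.mem_range] at hp
        rw [ih _ (by omega), show 2*n - (n-p) = n+p by omega]
      rw [this, hockey]
      have e : 2*(n+1)-j = (2*n-(j-1))+1 := by omega
      rw [e, show n + (n+1-j) = 2*n-(j-1) by omega, Nat.choose_succ_succ _ n, Nat.choose_succ_succ _ (n+1)]
      push_cast; ring
    intro j hj
    rcases Nat.eq_zero_or_pos j with rfl | h
    · rw [g_zero_one, main 1 le_rfl (by omega)]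
      exact (G_zero_one n).symm
    · exact main j h hj

theorem card_av (n : ℕ) : {σ : Equiv.Perm (Fin n) | Av σ}.ncard = catalan n := by
  have h := g_formula n 0 (by omega)
  have : g n 0 = {σ : Equiv.Perm (Fin n) | Av σ}.ncard := by
    unfold g
    congr 1
    ext σ
    have h0 : Suf 0 σ := by intro x y _ h; simp at h; omega
    simp [h0]
  rw [← this]
  have h2 := succ_mul_catalan_eq_centralBinom n
  rw [Nat.centralBinom] at h2
  have h3 := Nat.choose_succ_right_eq (2*n) n
  rw [show 2*n - n = n by omega] at h3
  simp at h
  zify at h2 h3 ⊢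
  have : ((n:ℤ)+1) * g n 0 = (n+1) * catalan n := by
    rw [h, h2]; linarith
  exact mul_left_cancel₀ (by positivity) this

def Inc {n : ℕ} (l k a : ℕ) (σ : Equiv.Perm (Fin n)) : Prop :=
  ∀ t < l, ∃ i : Fin n, (i : ℕ) = a + t ∧ (σ i : ℕ) = k + t

def Cl {n : ℕ} (l k a : ℕ) (σ : Equiv.Perm (Fin n)) : Prop :=
  ∀ i : Fin n, (a ≤ (i:ℕ) ∧ (i:ℕ) < a + l) ↔ (k ≤ (σ i : ℕ) ∧ (σ i : ℕ) < k + l)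

theorem Inc.cl {n l k a : ℕ} {σ : Equiv.Perm (Fin n)} (h : Inc l k a σ) : Cl l k a σ := by
  intro i
  constructor
  · rintro ⟨h1, h2⟩
    obtain ⟨j, hj, hj'⟩ := h (i - a) (by omega)
    obtain rfl : j = i := Fin.ext (by omega)
    omega
  · rintro ⟨h1, h2⟩
    obtain ⟨j, hj, hj'⟩ := h (σ i - k) (by omega)
    obtain rfl : j = i := σ.injective (Fin.ext (by omega))
    omega

theorem cluster_iff {n l k a : ℕ} (hk : k + l ≤ n) (σ : Equiv.Perm (Fin n)) :
    ClusterAt l (k+1) (a+1) σ ↔ Cl l k a σ := by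
  unfold ClusterAt
  constructor
  · intro h i
    have h' := Finset.ext_iff.1 h (σ i + 1)
    simp only [Finset.mem_image, Finset.mem_filter, Finset.mem_univ, true_and, Finset.mem_Ico] at h'
    constructor
    · intro hi
      have := h'.1 ⟨i, by omega, rfl⟩
      omega
    · intro hi
      obtain ⟨j, hj, hj'⟩ := h'.2 (by omega)
      obtain rfl : j = i := σ.injective (Fin.ext (by omega))
      omega
  · intro h
    ext y
    simp only [Finset.mem_image, Finset.mem_filter, Finset.mem_univ, true_and, Finset.mem_Ico]
    constructor
    · rintro ⟨i, hi, rfl⟩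
      have := (h i).1 (by omega)
      omega
    · intro hy
      have hlt : y - 1 < n := by omega
      have e : ((σ (σ.symm ⟨y-1, hlt⟩) : Fin n) : ℕ) = y - 1 := by simp
      have := (h (σ.symm ⟨y-1, hlt⟩)).2 (by omega)
      exact ⟨σ.symm ⟨y-1, hlt⟩, by omega, by omega⟩

theorem shift_lem (f : ℕ → ℕ) (k l : ℕ) (hm : ∀ s t, s < t → t < l → f s < f t)
    (hb : ∀ t < l, k ≤ f t ∧ f t < k + l) : ∀ t < l, f t = k + t := by
  have lo : ∀ t, t < l → k + t ≤ f t := by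
    intro t
    induction t with
    | zero => intro h; exact (hb 0 h).1
    | succ t ih =>
      intro h
      have := ih (by omega)
      have := hm t (t+1) (by omega) h
      omega
  have hi : ∀ s, ∀ t, t + s + 1 = l → f t + s < k + l := by
    intro s
    induction s with
    | zero => intro t ht; exact (hb t (by omega)).2
    | succ s ih =>
      intro t ht
      have := ih (t+1) (by omega)
      have := hm t (t+1) (by omega) (by omega)
      omega
  intro t ht
  have := lo t ht
  have := hi (l - 1 - t) t (by omega)
  omega

theorem inc_of_no_desc {n l k a : ℕ} (ha : a + l ≤ n) {σ : Equiv.Perm (Fin n)} (h : Cl l k a σ)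
    (hd : ∀ x y : Fin n, x < y → a ≤ (x:ℕ) → (y:ℕ) < a + l → σ x < σ y) : Inc l k a σ := by
  have := shift_lem (fun t => if ht : a + t < n then (σ ⟨a+t, ht⟩ : ℕ) else 0) k l ?_ ?_
  · intro t ht
    have h1 := this t ht
    have h2 : a + t < n := by omega
    simp only [h2, dite_true] at h1
    exact ⟨⟨a+t, h2⟩, rfl, h1⟩
  · intro s t hst ht
    have h1 : a + s < n := by omega
    have h2 : a + t < n := by omega
    simp only [h1, h2, dite_true]
    exact hd _ _ (by rw [Fin.lt_def]; simpa) (by simp) (by simpa)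
  · intro t ht
    have h2 : a + t < n := by omega
    simp only [h2, dite_true]
    exact (h ⟨a+t, h2⟩).1 (by simpa)

theorem desc_struct {n l k a : ℕ} (ha : a + l ≤ n) (hk : k + l ≤ n) {σ : Equiv.Perm (Fin n)}
    (hav : Av σ) (h : Cl l k a σ) (hi : ¬ Inc l k a σ) :
    a = k ∧ ∀ i : Fin n, (i : ℕ) < a ↔ (σ i : ℕ) < k := by
  have hd : ∃ x y : Fin n, x < y ∧ a ≤ (x:ℕ) ∧ (y:ℕ) < a + l ∧ σ y < σ x := by
    by_contra hc
    apply hi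
    apply inc_of_no_desc ha h
    intro x y h1 h2 h3
    by_contra h4
    exact hc ⟨x, y, h1, h2, h3, lt_of_le_of_ne (not_lt.1 h4) (fun h => h1.ne' (σ.injective h))⟩
  obtain ⟨x, y, hxy, hx, hy, hs⟩ := hd
  rw [Fin.lt_def] at hxy
  have wx := (h x).1 (by omega)
  have wy := (h y).1 (by omega)
  have key : ∀ i : Fin n, (i : ℕ) < a ↔ (σ i : ℕ) < k := by
    intro i
    have wi := h i
    constructor
    · intro h1
      by_contra h2
      refine hav i x y ?_ ?_ ?_ hs <;> rw [Fin.lt_def] <;> omega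
    · intro h1
      by_contra h2
      refine hav x y i ?_ ?_ hs ?_ <;> rw [Fin.lt_def] <;> omega
  refine ⟨?_, key⟩
  have c : (Finset.univ.filter fun i : Fin n => (i:ℕ) < a).card =
      (Finset.univ.filter fun i : Fin n => (i:ℕ) < k).card := by
    apply Finset.card_bij (fun i _ => σ i)
    · intro i hi; simp at hi ⊢; exact (key i).1 hi
    · intro i _ j _ h; exact σ.injective h
    · intro j hj; simp at hj; exact ⟨σ.symm j, by simp; exact (key _).2 (by simpa), by simp⟩
  rw [Fin.card_filter_val_lt, Fin.card_filter_val_lt] at c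
  omega

theorem pa_val {n : ℕ} (q : Fin n) (x : Fin (n+1)) :
    (q.predAbove x : ℕ) = if (q:ℕ) < x then (x:ℕ) - 1 else x := by
  unfold Fin.predAbove
  simp only [Fin.lt_def, Fin.val_castSucc]
  split_ifs <;> simp

theorem pa_sa {n : ℕ} (q i : Fin n) : q.predAbove (q.succ.succAbove i) = i := by
  apply Fin.ext
  rw [pa_val]
  unfold Fin.succAbove
  simp only [Fin.lt_def, Fin.val_castSucc, Fin.val_succ]
  split_ifs <;> simp_all <;> omega

theorem av_ins_dup {n : ℕ} (q : Fin n) (η : Equiv.Perm (Fin n)) (h : Av η) :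
    Av (ins q.succ (η q).succ η) := by
  set σ := ins q.succ (η q).succ η with hσ
  have hq : σ q.succ = (η q).succ := by simp [hσ]
  have hq' : σ q.castSucc = (η q).castSucc := by
    have := ins_succAbove q.succ (η q).succ η q
    simpa using this
  have key : ∀ x, η (q.predAbove x) = (η q).predAbove (σ x) := by
    intro x
    rcases Fin.eq_self_or_eq_succAbove q.succ x with rfl | ⟨i, rfl⟩
    · rw [hq]; simp
    · rw [hσ, ins_succAbove, pa_sa, pa_sa]
  have step : ∀ x y, x < y → σ y < σ x → q.predAbove x < q.predAbove y ∧
      η (q.predAbove y) < η (q.predAbove x) := by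
    intro x y hxy hs
    have h1 : q.predAbove x ≤ q.predAbove y := Fin.predAbove_right_monotone _ hxy.le
    have h2 : η (q.predAbove y) ≤ η (q.predAbove x) := by
      rw [key, key]; exact Fin.predAbove_right_monotone _ hs.le
    have h3 : q.predAbove x ≠ q.predAbove y := by
      intro he
      have : x = q.castSucc ∧ y = q.succ := by
        rw [Fin.lt_def] at hxy
        have he' := congrArg Fin.val he
        rw [pa_val, pa_val] at he'
        constructor <;> apply Fin.ext <;> simp only [Fin.val_castSucc, Fin.val_succ] <;>
          split_ifs at he' <;> omega
      obtain ⟨rfl, rfl⟩ := this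
      rw [hq, hq'] at hs
      rw [Fin.lt_def] at hs
      simp at hs
    refine ⟨lt_of_le_of_ne h1 h3, lt_of_le_of_ne h2 (fun h => h3 (η.injective h).symm)⟩
  intro i j k h1 h2 h3 h4
  obtain ⟨a1, a2⟩ := step i j h1 h3
  obtain ⟨b1, b2⟩ := step j k h2 h4
  exact h _ _ _ a1 b1 a2 b2

theorem inc_ins {n l k a : ℕ} (q w : Fin n) (hq : (q:ℕ) = a + l) (hw : (w:ℕ) = k + l)
    (η : Equiv.Perm (Fin n)) : Inc (l+2) k a (ins q.succ w.succ η) ↔ Inc (l+1) k a η := by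
  have sa : ∀ (q i : Fin n), (i:ℕ) ≤ q → q.succ.succAbove i = i.castSucc := by
    intro q i h
    apply Fin.succAbove_of_castSucc_lt
    rw [Fin.lt_def]; simp; omega
  constructor
  · intro h t ht
    obtain ⟨x, hx, hx'⟩ := h t (by omega)
    have hxn : (x:ℕ) < n := by omega
    obtain ⟨i, rfl⟩ : ∃ i : Fin n, x = i.castSucc := ⟨⟨x, hxn⟩, rfl⟩
    simp at hx
    rw [← sa q i (by omega), ins_succAbove] at hx'
    refine ⟨i, hx, ?_⟩
    by_cases hc : (η i : ℕ) ≤ w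
    · rw [sa _ _ hc] at hx'; simpa using hx'
    · rw [Fin.succAbove_of_le_castSucc _ _ (by rw [Fin.le_def]; simp; omega)] at hx'
      simp at hx'; omega
  · intro h t ht
    rcases Nat.lt_or_ge t (l+1) with h1 | h1
    · obtain ⟨i, hi, hi'⟩ := h t h1
      refine ⟨i.castSucc, by simpa, ?_⟩
      rw [← sa q i (by omega), ins_succAbove, sa _ _ (by omega)]
      simpa
    · refine ⟨q.succ, by simp; omega, by simp; omega⟩

theorem card_inc_step {n l k a : ℕ} (ha : a + l < n) (hk : k + l < n) :
    {σ : Equiv.Perm (Fin (n+1)) | Av σ ∧ Inc (l+2) k a σ}.ncard =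
    {σ : Equiv.Perm (Fin n) | Av σ ∧ Inc (l+1) k a σ}.ncard := by
  let q : Fin n := ⟨a+l, ha⟩
  let w : Fin n := ⟨k+l, hk⟩
  rw [← Set.ncard_image_of_injective _ (ins_inj q.succ w.succ)]
  congr 1
  ext σ
  constructor
  · rintro ⟨h1, h2⟩
    have hs : σ q.succ = w.succ := by
      obtain ⟨x, hx, hx'⟩ := h2 (l+1) (by omega)
      obtain rfl : x = q.succ := Fin.ext (by simp [q]; omega)
      exact Fin.ext (by simp [w]; omega)
    obtain ⟨η, rfl⟩ := ins_surj _ _ _ hs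
    exact ⟨η, ⟨av_of_ins _ _ _ h1, (inc_ins q w rfl rfl η).1 h2⟩, rfl⟩
  · rintro ⟨η, ⟨h1, h2⟩, rfl⟩
    refine ⟨?_, (inc_ins q w rfl rfl η).2 h2⟩
    obtain ⟨x, hx, hx'⟩ := h2 l (by omega)
    obtain rfl : x = q := Fin.ext (by simp [q]; omega)
    have : w = η q := Fin.ext (by simp only [w]; omega)
    rw [this]
    exact av_ins_dup _ _ h1

theorem card_inc {m k a : ℕ} (ha : a < m) (hk : k < m) (l : ℕ) :
    {σ : Equiv.Perm (Fin (m+l)) | Av σ ∧ Inc (l+1) k a σ}.ncard =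
    {σ : Equiv.Perm (Fin m) | Av σ ∧ Inc 1 k a σ}.ncard := by
  induction l with
  | zero => rfl
  | succ l ih =>
    rw [← ih]
    exact card_inc_step (n := m+l) (by omega) (by omega)

/-- direct sum -/
def dsum {m r : ℕ} (α : Equiv.Perm (Fin m)) (β : Equiv.Perm (Fin r)) : Equiv.Perm (Fin (m+r)) :=
  finSumFinEquiv.permCongr (Equiv.sumCongr α β)

@[simp] theorem dsum_left {m r : ℕ} (α : Equiv.Perm (Fin m)) (β : Equiv.Perm (Fin r)) (i : Fin m) :
    dsum α β (Fin.castAdd r i) = Fin.castAdd r (α i) := by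
  simp [dsum, Equiv.permCongr_apply]

@[simp] theorem dsum_right {m r : ℕ} (α : Equiv.Perm (Fin m)) (β : Equiv.Perm (Fin r)) (i : Fin r) :
    dsum α β (Fin.natAdd m i) = Fin.natAdd m (β i) := by
  simp [dsum, Equiv.permCongr_apply]

theorem dsum_inj {m r : ℕ} {α α' : Equiv.Perm (Fin m)} {β β' : Equiv.Perm (Fin r)}
    (h : dsum α β = dsum α' β') : α = α' ∧ β = β' := by
  constructor
  · ext i
    have := congrArg (fun e => ((e (Fin.castAdd r i) : Fin (m+r)) : ℕ)) h
    simpa using this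
  · ext i
    have := congrArg (fun e => ((e (Fin.natAdd m i) : Fin (m+r)) : ℕ)) h
    simpa using this

theorem dsum_surj {m r : ℕ} (σ : Equiv.Perm (Fin (m+r)))
    (h : ∀ i : Fin (m+r), (i:ℕ) < m ↔ (σ i : ℕ) < m) : ∃ α β, dsum α β = σ := by
  have h1 : ∀ i : Fin m, ∃ j : Fin m, Fin.castAdd r j = σ (Fin.castAdd r i) := by
    intro i
    have := (h (Fin.castAdd r i)).1 (by simp)
    exact ⟨⟨_, this⟩, Fin.ext rfl⟩
  have h2 : ∀ i : Fin r, ∃ j : Fin r, Fin.natAdd m j = σ (Fin.natAdd m i) := by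
    intro i
    have := (h (Fin.natAdd m i)).not.1 (by simp)
    exact ⟨⟨σ (Fin.natAdd m i) - m, by omega⟩, Fin.ext (by simp; omega)⟩
  choose f hf using h1
  choose g hg using h2
  have fi : Function.Injective f := by
    intro i j hij
    have : σ (Fin.castAdd r i) = σ (Fin.castAdd r j) := by rw [← hf, ← hf, hij]
    exact Fin.castAdd_injective _ _ (σ.injective this)
  have gi : Function.Injective g := by
    intro i j hij
    have : σ (Fin.natAdd m i) = σ (Fin.natAdd m j) := by rw [← hg, ← hg, hij]
    exact Fin.natAdd_injective _ _ (σ.injective this)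
  refine ⟨Equiv.ofBijective f (Finite.injective_iff_bijective.1 fi),
    Equiv.ofBijective g (Finite.injective_iff_bijective.1 gi), ?_⟩
  apply Equiv.ext
  intro x
  induction x using Fin.addCases with
  | left i => simp [hf]
  | right i => simp [hg]

theorem av_dsum {m r : ℕ} (α : Equiv.Perm (Fin m)) (β : Equiv.Perm (Fin r)) :
    Av (dsum α β) ↔ Av α ∧ Av β := by
  constructor
  · intro h
    constructor
    · intro i j k h1 h2 h3 h4
      refine h (Fin.castAdd r i) (Fin.castAdd r j) (Fin.castAdd r k) ?_ ?_ ?_ ?_ <;>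
        simpa
    · intro i j k h1 h2 h3 h4
      refine h (Fin.natAdd m i) (Fin.natAdd m j) (Fin.natAdd m k) ?_ ?_ ?_ ?_ <;>
        simpa
  · rintro ⟨h, h'⟩ i j k h1 h2 h3 h4
    induction i using Fin.addCases with
    | left i =>
      induction j using Fin.addCases with
      | left j =>
        induction k using Fin.addCases with
        | left k => 
          simp at h1 h2 h3 h4
          exact h i j k h1 h2 h3 h4
        | right k => simp [Fin.lt_def] at h4; omega
      | right j => simp [Fin.lt_def] at h3; omega
    | right i =>
      induction j using Fin.addCases with
      | left j => simp [Fin.lt_def] at h1; omega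
      | right j =>
        induction k using Fin.addCases with
        | left k => simp [Fin.lt_def] at h2; omega
        | right k =>
          simp at h1 h2 h3 h4
          exact h' i j k h1 h2 h3 h4

theorem dsum_lt {m r : ℕ} (α : Equiv.Perm (Fin m)) (β : Equiv.Perm (Fin r)) (i : Fin (m+r)) :
    (i:ℕ) < m ↔ (dsum α β i : ℕ) < m := by
  induction i using Fin.addCases with
  | left i => simp
  | right i => simp

theorem inc_dsum {k l r : ℕ} (α : Equiv.Perm (Fin k)) (π : Equiv.Perm (Fin l)) (β : Equiv.Perm (Fin r)) :
    Inc l k k (dsum (dsum α π) β) ↔ π = 1 := by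
  have e : ∀ i : Fin l, (dsum (dsum α π) β (Fin.castAdd r (Fin.natAdd k i)) : ℕ) = k + π i := by
    intro i; simp
  constructor
  · intro h
    ext i
    obtain ⟨x, hx, hx'⟩ := h i i.2
    obtain rfl : x = Fin.castAdd r (Fin.natAdd k i) := Fin.ext (by simpa)
    rw [e] at hx'
    simpa using hx'
  · rintro rfl t ht
    exact ⟨Fin.castAdd r (Fin.natAdd k ⟨t, ht⟩), by simp, by rw [e]; simp⟩

theorem card_noninc (k l r : ℕ) :
    {σ : Equiv.Perm (Fin (k+l+r)) | (Av σ ∧ Cl l k k σ) ∧ ¬ Inc l k k σ}.ncard =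
    catalan k * catalan r * (catalan l - 1) := by
  let F : (Equiv.Perm (Fin k) × Equiv.Perm (Fin r)) × Equiv.Perm (Fin l) → Equiv.Perm (Fin (k+l+r)) :=
    fun x => dsum (dsum x.1.1 x.2) x.1.2
  have hF : Function.Injective F := by
    rintro ⟨⟨a, b⟩, c⟩ ⟨⟨a', b'⟩, c'⟩ h
    obtain ⟨h1, rfl⟩ := dsum_inj h
    obtain ⟨rfl, rfl⟩ := dsum_inj h1
    rfl
  have h1 : ({σ : Equiv.Perm (Fin l) | Av σ} \ {1}).ncard = catalan l - 1 := by
    rw [Set.ncard_sdiff_singleton_of_mem, card_av]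
    intro i j k h1 h2 h3 h4
    simp at h3
    exact absurd h1 (not_lt.2 h3.le)
  rw [← h1, ← card_av k, ← card_av r, ← Set.ncard_prod, ← Set.ncard_prod,
    ← Set.ncard_image_of_injective _ hF]
  congr 1
  ext σ
  constructor
  · rintro ⟨⟨h1, h2⟩, h3⟩
    have h4 := (desc_struct (by omega) (by omega) h1 h2 h3).2
    obtain ⟨σ', β, rfl⟩ := dsum_surj σ (by
      intro i
      have := h4 i
      have := h2 i
      omega)
    obtain ⟨α, π, rfl⟩ := dsum_surj σ' (by
      intro i
      have := h4 (Fin.castAdd r i)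
      simpa using this)
    rw [inc_dsum] at h3
    rw [av_dsum, av_dsum] at h1
    exact ⟨((α, β), π), ⟨⟨h1.1.1, h1.2⟩, h1.1.2, h3⟩, rfl⟩
  · rintro ⟨⟨⟨α, β⟩, π⟩, ⟨⟨h1, h2⟩, h3, h4⟩, rfl⟩
    refine ⟨⟨(av_dsum _ _).2 ⟨(av_dsum _ _).2 ⟨h1, h3⟩, h2⟩, ?_⟩, (inc_dsum _ _ _).not.2 h4⟩
    intro i
    have a1 := dsum_lt (dsum α π) β i
    induction i using Fin.addCases with
    | left i =>
      have := dsum_lt α π i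
      simp [F] at *
      omega
    | right i =>
      simp [F] at *

/-- for `τ = 321`, the number of 321-avoiding permutations in
`A^{(n)}_{l;k;a}` equals `|{η ∈ S_{n-l+1}(321) : η_a = k}|` if `a ≠ k`, with the additional
term `C_{k-1} C_{n-k-l+1} (C_l - 1)` if `a = k`. -/
theorem avoid321_cluster_at_position (n : ℕ) (hn : 3 ≤ n) (l : ℕ) (hl2 : 2 ≤ l)
    (hln : l ≤ n - 1)
    (k a : ℕ) (hk1 : 1 ≤ k) (hk2 : k ≤ n - l + 1) (ha1 : 1 ≤ a) (ha2 : a ≤ n - l + 1) :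
    (a ≠ k →
      {σ : Equiv.Perm (Fin n) | ClusterAt l k a σ ∧ Avoids ⇑σ ⇑perm321}.ncard =
        {η : Equiv.Perm (Fin (n - l + 1)) | Avoids ⇑η ⇑perm321 ∧
          ∃ i : Fin (n - l + 1), (i : ℕ) + 1 = a ∧ (η i : ℕ) + 1 = k}.ncard) ∧
    (a = k →
      {σ : Equiv.Perm (Fin n) | ClusterAt l k a σ ∧ Avoids ⇑σ ⇑perm321}.ncard =
        {η : Equiv.Perm (Fin (n - l + 1)) | Avoids ⇑η ⇑perm321 ∧
          ∃ i : Fin (n - l + 1), (i : ℕ) + 1 = a ∧ (η i : ℕ) + 1 = k}.ncard +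
        catalan (k - 1) * catalan (n + 1 - k - l) * (catalan l - 1)) := by
  obtain ⟨k, rfl⟩ : ∃ k', k = k' + 1 := ⟨k - 1, by omega⟩
  obtain ⟨a, rfl⟩ : ∃ a', a = a' + 1 := ⟨a - 1, by omega⟩
  obtain ⟨l, rfl⟩ : ∃ l', l = l' + 1 := ⟨l - 1, by omega⟩
  obtain ⟨m, rfl⟩ : ∃ m, n = m + l := ⟨n - l, by omega⟩
  obtain rfl | hm : m = 0 ∨ 0 < m := by omega
  · omega
  have em : m + l - (l + 1) + 1 = m := by omega
  rw [em]
  rw [em] at hk2 ha2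
  have e1 : {σ : Equiv.Perm (Fin (m + l)) | ClusterAt (l + 1) (k + 1) (a + 1) σ ∧ Avoids ⇑σ ⇑perm321} =
      {σ | Av σ ∧ Inc (l+1) k a σ} ∪ {σ | (Av σ ∧ Cl (l+1) k a σ) ∧ ¬ Inc (l+1) k a σ} := by
    ext σ
    simp only [Set.mem_ofPred_eq, Set.mem_union]
    rw [cluster_iff (by omega), avoids_iff]
    have := @Inc.cl _ (l+1) k a σ
    tauto
  have e2 : {η : Equiv.Perm (Fin m) | Avoids ⇑η ⇑perm321 ∧
          ∃ i : Fin m, (i : ℕ) + 1 = a + 1 ∧ (η i : ℕ) + 1 = k + 1} =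
      {σ | Av σ ∧ Inc 1 k a σ} := by
    ext σ
    simp only [Set.mem_ofPred_eq]
    rw [avoids_iff]
    simp [Inc]
  rw [e1, e2, Set.ncard_union_eq (by
    rw [Set.disjoint_left]
    rintro σ ⟨_, h⟩ ⟨_, h'⟩
    exact h' h) (Set.toFinite _) (Set.toFinite _), card_inc (by omega) (by omega)]
  constructor
  · intro hne
    have : {σ : Equiv.Perm (Fin (m + l)) | (Av σ ∧ Cl (l+1) k a σ) ∧ ¬ Inc (l+1) k a σ} = ∅ := by
      ext σ
      simp only [Set.mem_ofPred_eq, Set.mem_empty_iff_false, iff_false]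
      rintro ⟨⟨h1, h2⟩, h3⟩
      have := (desc_struct (by omega) (by omega) h1 h2 h3).1
      omega
    rw [this]; simp
  · intro he
    obtain rfl : a = k := by omega
    obtain ⟨r, hr⟩ : ∃ r, m + l = a + (l+1) + r := ⟨m + l - (a + (l+1)), by omega⟩
    have e3 : m + l + 1 - (a+1) - (l+1) = r := by omega
    rw [e3, hr, card_noninc]
    simp
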